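/- (Theorem B.) Let L = A_0 + A_1 D (A_1 invertible) and B = Σ_{j=0}^n B_j D^j (n ≥ 1) be MODOs over M_ℓ(K). Suppose there exists a differential field extension E of K containing differential constants λ, μ algebraically independent over K, together with a fundamental matrix Ψ ∈ M_ℓ(E) for L − λ, and suppose L̂ ∘ B̂ = B̂ ∘ L̂ on E^ℓ. Then the differential resultant f(λ,μ) = det M(L−λ, B−μ), regarded as a polynomial in K[λ,μ], has all its coefficients in C; that is, f(λ,μ) ∈ C[λ,μ]. -/

import Mathlib

open Matrix Polynomial Finset

/-- A derivation-like map on a commutative ring: additive and satisfying the Leibniz rule. -/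
def IsDeriv {R : Type*} [CommRing R] (d : R → R) : Prop :=
  (∀ a b, d (a + b) = d a + d b) ∧ (∀ a b, d (a * b) = d a * b + a * d b)

/-- The recursively defined matrices `p_j(N)`:
`p_0(N) = 1`, `p_{j+1}(N) = p_j(N) * N + (p_j(N))'`. -/
def pMat {R : Type*} [CommRing R] (d : R → R) {l : ℕ}
    (N : Matrix (Fin l) (Fin l) R) : ℕ → Matrix (Fin l) (Fin l) R
  | 0 => 1
  | j + 1 => pMat d N j * N + (pMat d N j).map d

/-- Entrywise derivative of a vector. -/
def dVec {R : Type*} (d : R → R) {l : ℕ} (v : Fin l → R) : Fin l → R :=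
  fun i => d (v i)

/-- Entrywise derivative of a matrix. -/
def dMat {R : Type*} (d : R → R) {l : ℕ} (A : Matrix (Fin l) (Fin l) R) :
    Matrix (Fin l) (Fin l) R :=
  A.map d

/-- Action of the first-order operator `P = A₀ + A₁ D` on vectors with entries in a
differential extension `E` of `K` (with embedding `ι` and derivation `dE`). -/
def opP {K E : Type*} [CommRing K] [CommRing E] (ι : K →+* E) (dE : E → E) {l : ℕ}
    (A0 A1 : Matrix (Fin l) (Fin l) K) (ψ : Fin l → E) : Fin l → E :=
  (A0.map ι).mulVec ψ + (A1.map ι).mulVec (dVec dE ψ)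

/-- Action of the operator `Q = Σ_{j=0}^n B_j D^j` on vectors with entries in a
differential extension `E` of `K`. -/
def opQ {K E : Type*} [CommRing K] [CommRing E] (ι : K →+* E) (dE : E → E) {l : ℕ}
    (n : ℕ) (Bc : ℕ → Matrix (Fin l) (Fin l) K) (ψ : Fin l → E) : Fin l → E :=
  ∑ j ∈ Finset.range (n + 1), ((Bc j).map ι).mulVec ((dVec dE)^[j] ψ)

/-- Columnwise action of `Q = Σ_{j=0}^n B_j D^j` on matrices. -/
def opQMat {K E : Type*} [CommRing K] [CommRing E] (ι : K →+* E) (dE : E → E) {l : ℕ}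
    (n : ℕ) (Bc : ℕ → Matrix (Fin l) (Fin l) K) (Ψ : Matrix (Fin l) (Fin l) E) :
    Matrix (Fin l) (Fin l) E :=
  ∑ j ∈ Finset.range (n + 1), (Bc j).map ι * (dMat dE)^[j] Ψ

/-- The matrix `M(P,Q) = Σ_{j=0}^n B_j p_j(N)` with `N = -A₁⁻¹A₀`. -/
noncomputable def MPQ {K : Type*} [Field K] (dK : K → K) {l : ℕ}
    (n : ℕ) (A0 A1 : Matrix (Fin l) (Fin l) K) (Bc : ℕ → Matrix (Fin l) (Fin l) K) :
    Matrix (Fin l) (Fin l) K :=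
  ∑ j ∈ Finset.range (n + 1), Bc j * pMat dK (-(A1⁻¹ * A0)) j

/-- Coefficientwise extension of a derivation to polynomials (the variable is a constant). -/
noncomputable def dPoly {K : Type*} [CommRing K] (d : K → K) (p : Polynomial K) : Polynomial K :=
  p.sum fun n a => Polynomial.C (d a) * Polynomial.X ^ n

/-- `N_λ = -A₁⁻¹ (A₀ - λ·1)` as a matrix over `K[λ]`. -/
noncomputable def Nlam {K : Type*} [Field K] {l : ℕ} (A0 A1 : Matrix (Fin l) (Fin l) K) :
    Matrix (Fin l) (Fin l) (Polynomial K) :=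
  -((A1⁻¹).map (Polynomial.C : K →+* Polynomial K) *
      (A0.map (Polynomial.C : K →+* Polynomial K)
        - (Polynomial.X : Polynomial K) • (1 : Matrix (Fin l) (Fin l) (Polynomial K))))

/-- `M(L-λ, B-μ) = Σ_{j=0}^n B_j p_j(N_λ) - μ·1` as a matrix over `K[λ][μ]`
(inner variable `λ`, outer variable `μ`). -/
noncomputable def Mspec {K : Type*} [Field K] (dK : K → K) {l : ℕ}
    (n : ℕ) (A0 A1 : Matrix (Fin l) (Fin l) K) (Bc : ℕ → Matrix (Fin l) (Fin l) K) :
    Matrix (Fin l) (Fin l) (Polynomial (Polynomial K)) :=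
  (∑ j ∈ Finset.range (n + 1),
      (Bc j).map (Polynomial.C.comp Polynomial.C : K →+* Polynomial (Polynomial K)) *
        (pMat (dPoly dK) (Nlam A0 A1) j).map
          (Polynomial.C : Polynomial K →+* Polynomial (Polynomial K)))
    - (Polynomial.X : Polynomial (Polynomial K)) •
        (1 : Matrix (Fin l) (Fin l) (Polynomial (Polynomial K)))

/-- The differential resultant `f(λ,μ) = det M(L-λ, B-μ)` as an element of `K[λ][μ]`. -/
noncomputable def fSpec {K : Type*} [Field K] (dK : K → K) {l : ℕ}
    (n : ℕ) (A0 A1 : Matrix (Fin l) (Fin l) K) (Bc : ℕ → Matrix (Fin l) (Fin l) K) :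
    Polynomial (Polynomial K) :=
  (Mspec dK n A0 A1 Bc).det

/-- Evaluation `K[λ][μ] → E` at `λ = a`, `μ = b` (through `ι : K →+* E`). -/
noncomputable def evalLM {K E : Type*} [CommRing K] [CommRing E] (ι : K →+* E) (a b : E) :
    Polynomial (Polynomial K) →+* E :=
  Polynomial.eval₂RingHom (Polynomial.eval₂RingHom ι a) b

/-- `N_λ` with `λ` specialized to an element `lam` of an extension `E`. -/
noncomputable def NlamE {K E : Type*} [Field K] [CommRing E] (ι : K →+* E) (lam : E) {l : ℕ}
    (A0 A1 : Matrix (Fin l) (Fin l) K) : Matrix (Fin l) (Fin l) E :=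
  -((A1⁻¹).map ι * (A0.map ι - lam • 1))

/-- `g(L,B)` applied to `ψ`, for `g` a polynomial in two variables over `C₀`
(inner variable `λ` substituted by `Lh`, outer variable `μ` substituted by `Bh`). -/
noncomputable def applyPoly {C₀ E : Type*} [CommRing C₀] [CommRing E] (ιc : C₀ →+* E) {l : ℕ}
    (Lh Bh : (Fin l → E) → (Fin l → E)) (g : Polynomial (Polynomial C₀)) (ψ : Fin l → E) :
    Fin l → E :=
  ∑ i ∈ Finset.range (g.natDegree + 1),
    ∑ k ∈ Finset.range ((g.coeff i).natDegree + 1),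
      ιc ((g.coeff i).coeff k) • Lh^[k] (Bh^[i] ψ)

section helpers

lemma IsDeriv.zero' {R : Type*} [CommRing R] {d : R → R} (h : IsDeriv d) : d 0 = 0 := by
  have := h.1 0 0
  simpa using this

lemma IsDeriv.one' {R : Type*} [CommRing R] {d : R → R} (h : IsDeriv d) : d 1 = 0 := by
  have := h.2 1 1
  simpa using this

lemma IsDeriv.neg' {R : Type*} [CommRing R] {d : R → R} (h : IsDeriv d) (a : R) :
    d (-a) = - d a := by
  have := h.1 a (-a)
  rw [add_neg_cancel, h.zero'] at this
  exact (neg_eq_of_add_eq_zero_right this.symm).symm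

lemma IsDeriv.sum' {R : Type*} [CommRing R] {d : R → R} (h : IsDeriv d) {α : Type*}
    (s : Finset α) (f : α → R) : d (∑ i ∈ s, f i) = ∑ i ∈ s, d (f i) :=
  map_sum (AddMonoidHom.mk' d h.1) f s

lemma IsDeriv.pow_const {R : Type*} [CommRing R] {d : R → R} (h : IsDeriv d) {a : R}
    (ha : d a = 0) (k : ℕ) : d (a ^ k) = 0 := by
  induction k with
  | zero => simpa using h.one'
  | succ k ih => rw [pow_succ, h.2, ih, ha]; simp

/-- constants subring -/
def constRing {R : Type*} [CommRing R] (d : R → R) (h : IsDeriv d) : Subring R where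
  carrier := {a | d a = 0}
  mul_mem' := by
    intro a b ha hb
    simp only [Set.mem_setOf_eq] at *
    rw [h.2, ha, hb]; simp
  one_mem' := h.one'
  add_mem' := by
    intro a b ha hb
    simp only [Set.mem_setOf_eq] at *
    rw [h.1, ha, hb]; simp
  zero_mem' := h.zero'
  neg_mem' := by
    intro a ha
    simp only [Set.mem_setOf_eq] at *
    rw [h.neg', ha]; simp

lemma det_const {R : Type*} [CommRing R] {d : R → R} (h : IsDeriv d) {l : ℕ}
    (G : Matrix (Fin l) (Fin l) R) (hG : dMat d G = 0) : d G.det = 0 := by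
  have h0 : ∀ i j, G i j ∈ constRing d h := fun i j => congrFun (congrFun hG i) j
  have : G.det ∈ constRing d h := by
    rw [Matrix.det_apply]
    refine Subring.sum_mem _ fun σ _ => ?_
    rw [Units.smul_def]
    refine Subring.zsmul_mem _ ?_ _
    exact Subring.prod_mem _ fun i _ => h0 _ _
  exact this

lemma dMat_mul {R : Type*} [CommRing R] {d : R → R} (h : IsDeriv d) {l : ℕ}
    (A B : Matrix (Fin l) (Fin l) R) : dMat d (A * B) = dMat d A * B + A * dMat d B := by
  ext i j
  simp [dMat, Matrix.mul_apply, h.sum', h.2, Finset.sum_add_distrib]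

lemma dMat_smul {R : Type*} [CommRing R] {d : R → R} (h : IsDeriv d) {l : ℕ} {c : R} (hc : d c = 0)
    (B : Matrix (Fin l) (Fin l) R) : dMat d (c • B) = c • dMat d B := by
  ext i j
  simp [dMat, h.2, hc]

lemma dMat_iter_smul {R : Type*} [CommRing R] {d : R → R} (h : IsDeriv d) {l : ℕ} {c : R}
    (hc : d c = 0) (k : ℕ) (B : Matrix (Fin l) (Fin l) R) :
    (dMat d)^[k] (c • B) = c • (dMat d)^[k] B := by
  induction k with
  | zero => rfl
  | succ k ih => rw [Function.iterate_succ_apply', ih, dMat_smul h hc, Function.iterate_succ_apply']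

lemma dMat_iter_fund {R : Type*} [CommRing R] {d : R → R} (h : IsDeriv d) {l : ℕ}
    {N P : Matrix (Fin l) (Fin l) R} (hP : dMat d P = N * P) (k : ℕ) :
    (dMat d)^[k] P = pMat d N k * P := by
  induction k with
  | zero => simp [pMat]
  | succ k ih =>
    rw [Function.iterate_succ_apply', ih, dMat_mul h, hP, pMat, Matrix.add_mul, Matrix.mul_assoc,
      add_comm]
    rfl

lemma pMat_map {R S : Type*} [CommRing R] [CommRing S] {d : R → R} {d' : S → S} (φ : R →+* S)
    (h : ∀ a, d' (φ a) = φ (d a)) {l : ℕ} (N : Matrix (Fin l) (Fin l) R) (k : ℕ) :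
    (pMat d N k).map φ = pMat d' (N.map φ) k := by
  induction k with
  | zero => simp [pMat]
  | succ k ih =>
    rw [pMat, pMat, ← ih, ← Matrix.map_mul]
    ext i j
    simp [h, Matrix.mul_apply]

lemma coeff_dPoly {R : Type*} [CommRing R] {d : R → R} (h : d 0 = 0) (p : Polynomial R) (k : ℕ) :
    (dPoly d p).coeff k = d (p.coeff k) := by
  rw [dPoly, Polynomial.sum, Polynomial.finset_sum_coeff]
  simp only [Polynomial.coeff_C_mul_X_pow]
  rw [Finset.sum_ite_eq]
  split_ifs with hk
  · rfl
  · rw [Polynomial.notMem_support_iff.1 hk, h]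

lemma dPoly_zero {R : Type*} [CommRing R] {d : R → R} : dPoly d (0 : Polynomial R) = 0 := by
  simp [dPoly]

lemma dPoly_add {R : Type*} [CommRing R] {d : R → R} (h0 : d 0 = 0)
    (h : ∀ a b, d (a + b) = d a + d b) (p q : Polynomial R) :
    dPoly d (p + q) = dPoly d p + dPoly d q := by
  ext k
  simp [coeff_dPoly h0, h]

lemma eval_dPoly {R S : Type*} [CommRing R] [CommRing S] {d : R → R} {d' : S → S}
    (h0 : d 0 = 0) (hadd : ∀ a b, d (a + b) = d a + d b) (hd' : IsDeriv d')
    (φ : R →+* S) (h : ∀ a, d' (φ a) = φ (d a)) (c : S) (hc : d' c = 0) (p : Polynomial R) :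
    d' (Polynomial.eval₂RingHom φ c p) = Polynomial.eval₂RingHom φ c (dPoly d p) := by
  induction p using Polynomial.induction_on' with
  | add p q hp hq => rw [map_add, hd'.1, hp, hq, dPoly_add h0 hadd, map_add]
  | monomial k a =>
    have : dPoly d (Polynomial.monomial k a) = Polynomial.monomial k (d a) := by
      ext m
      rw [coeff_dPoly h0, Polynomial.coeff_monomial, Polynomial.coeff_monomial]
      split_ifs <;> simp [h0]
    rw [this]
    simp [Polynomial.eval₂_monomial, hd'.2, hd'.pow_const hc, h]

lemma dVec_iter_col {R : Type*} (d : R → R) {l : ℕ} (X : Matrix (Fin l) (Fin l) R) (c : Fin l)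
    (k : ℕ) : (dVec d)^[k] (fun i => X i c) = fun i => ((dMat d)^[k] X) i c := by
  induction k with
  | zero => rfl
  | succ k ih => rw [Function.iterate_succ_apply', ih, Function.iterate_succ_apply']; rfl

lemma opQ_col {K E : Type*} [CommRing K] [CommRing E] (ι : K →+* E) (dE : E → E) {l : ℕ}
    (n : ℕ) (Bc : ℕ → Matrix (Fin l) (Fin l) K) (X : Matrix (Fin l) (Fin l) E) (c : Fin l) :
    opQ ι dE n Bc (fun i => X i c) = fun i => opQMat ι dE n Bc X i c := by
  ext i
  simp only [opQ, opQMat, dVec_iter_col, Finset.sum_apply, Matrix.sum_apply]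
  rfl

lemma opP_col {K E : Type*} [CommRing K] [CommRing E] (ι : K →+* E) (dE : E → E) {l : ℕ}
    (A0 A1 : Matrix (Fin l) (Fin l) K) (X : Matrix (Fin l) (Fin l) E) (c : Fin l) :
    opP ι dE A0 A1 (fun i => X i c) = fun i => (A0.map ι * X + A1.map ι * dMat dE X) i c := by
  rfl

end helpers

/-- Theorem B: if `L` and `B` commute then the differential resultant
`f(λ,μ) = det M(L-λ, B-μ)` has all its coefficients in the field of constants of `K`. -/
theorem statement9 {K E : Type*} [Field K] [Field E] [CharZero K]
    (dK : K → K) (hdK : IsDeriv dK) (dE : E → E) (hdE : IsDeriv dE)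
    (ι : K →+* E) (hcomp : ∀ a : K, dE (ι a) = ι (dK a))
    (lam mu : E) (hlam : dE lam = 0) (hmu : dE mu = 0)
    (halg : Function.Injective (evalLM ι lam mu))
    {l : ℕ} (hl : 1 ≤ l)
    (A0 A1 : Matrix (Fin l) (Fin l) K) (hA1 : IsUnit A1.det)
    (n : ℕ) (hn : 1 ≤ n) (Bc : ℕ → Matrix (Fin l) (Fin l) K)
    (hcomm : ∀ ψ : Fin l → E,
      opP ι dE A0 A1 (opQ ι dE n Bc ψ) = opQ ι dE n Bc (opP ι dE A0 A1 ψ))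
    (Ψ : Matrix (Fin l) (Fin l) E) (hΨu : IsUnit Ψ.det)
    (hΨ : dMat dE Ψ = NlamE ι lam A0 A1 * Ψ) :
    ∀ i j : ℕ, dK (((fSpec dK n A0 A1 Bc).coeff i).coeff j) = 0 := by
  have hinv : (A1⁻¹).map ι * A1.map ι = 1 := by
    rw [← Matrix.map_mul, Matrix.nonsing_inv_mul _ hA1]; simp
  have hinv' : A1.map ι * (A1⁻¹).map ι = 1 := by
    rw [← Matrix.map_mul, Matrix.mul_nonsing_inv _ hA1]; simp
  set N := NlamE ι lam A0 A1 with hN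
  have hAN : A1.map ι * N = lam • 1 - A0.map ι := by
    rw [hN, NlamE, Matrix.mul_neg, ← Matrix.mul_assoc, hinv', Matrix.one_mul, neg_sub]
  set W : Matrix (Fin l) (Fin l) E := ∑ j ∈ Finset.range (n + 1), (Bc j).map ι * pMat dE N j with hW
  have hQ : opQMat ι dE n Bc Ψ = W * Ψ := by
    simp only [opQMat, hW, Finset.sum_mul, dMat_iter_fund hdE hΨ, Matrix.mul_assoc]
  have hP : A0.map ι * Ψ + A1.map ι * dMat dE Ψ = lam • Ψ := by
    rw [hΨ, ← Matrix.mul_assoc, hAN, Matrix.sub_mul]; simp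
  have hQ2 : opQMat ι dE n Bc (lam • Ψ) = lam • (W * Ψ) := by
    rw [← hQ]
    simp only [opQMat, dMat_iter_smul hdE hlam, Matrix.mul_smul, Finset.smul_sum]
  have hLW : A0.map ι * (W * Ψ) + A1.map ι * dMat dE (W * Ψ) = lam • (W * Ψ) := by
    ext i c
    have := congrFun (hcomm (fun i => Ψ i c)) i
    rw [opQ_col, opP_col, opP_col, opQ_col, hP, hQ, hQ2] at this
    exact this
  have hWN : dMat dE (W * Ψ) = N * (W * Ψ) := by
    have h1 : A1.map ι * dMat dE (W * Ψ) = A1.map ι * (N * (W * Ψ)) := by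
      rw [← Matrix.mul_assoc _ N, hAN, Matrix.sub_mul]
      rw [Matrix.smul_mul, Matrix.one_mul, ← hLW]; abel
    have h2 := congrArg (fun Z => (A1⁻¹).map ι * Z) h1
    simpa only [← Matrix.mul_assoc _ (A1.map ι), hinv, Matrix.one_mul] using h2
  set M : Matrix (Fin l) (Fin l) E := W - mu • 1 with hM
  have hMN : dMat dE (M * Ψ) = N * (M * Ψ) := by
    have e1 : M * Ψ = W * Ψ - mu • Ψ := by rw [hM, Matrix.sub_mul]; simp
    have e2 : dMat dE (W * Ψ - mu • Ψ) = dMat dE (W * Ψ) - dMat dE (mu • Ψ) := by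
      ext i j
      simp [dMat, sub_eq_add_neg, hdE.1, hdE.neg']
    rw [e1, e2, hWN, dMat_smul hdE hmu, hΨ, Matrix.mul_sub, Matrix.mul_smul]
  set G := Ψ⁻¹ * (M * Ψ) with hG
  have hΨG : Ψ * G = M * Ψ := by
    rw [hG, ← Matrix.mul_assoc, Matrix.mul_nonsing_inv _ hΨu, Matrix.one_mul]
  have hdG : dMat dE G = 0 := by
    have h1 := hMN
    rw [← hΨG, dMat_mul hdE, hΨ, Matrix.mul_assoc] at h1
    have h2 : Ψ * dMat dE G = 0 := by simpa using h1
    have h3 := congrArg (fun Z => Ψ⁻¹ * Z) h2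
    simpa only [← Matrix.mul_assoc, Matrix.nonsing_inv_mul _ hΨu, Matrix.one_mul,
      Matrix.mul_zero] using h3
  have hdet : G.det = M.det := by
    have := congrArg Matrix.det hΨG
    rw [Matrix.det_mul Ψ G, Matrix.det_mul M Ψ, mul_comm] at this
    exact hΨu.mul_right_cancel this
  have hdM : dE M.det = 0 := hdet ▸ det_const hdE G hdG
  have hev := eval_dPoly hdK.zero' hdK.1 hdE ι hcomp lam hlam
  have hNl : (Nlam A0 A1).map (Polynomial.eval₂RingHom ι lam) = N := by
    ext i j
    simp [Nlam, hN, NlamE, Matrix.mul_apply, Matrix.one_apply, Polynomial.eval₂_finset_sum]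
    refine Finset.sum_congr rfl fun k _ => ?_
    split_ifs <;> simp
  have hMs : (Mspec dK n A0 A1 Bc).map (evalLM ι lam mu) = M := by
    have hp : ∀ j, (pMat dE N j) =
        (pMat (dPoly dK) (Nlam A0 A1) j).map (Polynomial.eval₂RingHom ι lam) := fun j => by
      rw [pMat_map _ hev, hNl]
    rw [hM, hW]
    simp only [hp]
    ext i j
    simp [Mspec, evalLM, Matrix.mul_apply, Matrix.one_apply, Polynomial.eval₂_finset_sum,
      Matrix.sum_apply]
    split_ifs <;> simp
  have hf : dE (evalLM ι lam mu (fSpec dK n A0 A1 Bc)) = 0 := by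
    rw [fSpec, RingHom.map_det, RingHom.mapMatrix_apply, hMs, hdM]
  have hd0 : dPoly dK 0 = 0 := dPoly_zero
  have hev2 := eval_dPoly hd0 (dPoly_add hdK.zero' hdK.1) hdE
    (Polynomial.eval₂RingHom ι lam) hev mu hmu (fSpec dK n A0 A1 Bc)
  have hz : dPoly (dPoly dK) (fSpec dK n A0 A1 Bc) = 0 := by
    apply halg
    rw [map_zero, ← hf]
    exact hev2.symm
  intro i j
  rw [← coeff_dPoly hdK.zero', ← coeff_dPoly hd0, hz]
  simp
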